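/- Let Γ be a core multigraph and γ ⊊ Γ a proper core subgraph. Then there is a natural bijection F(Γ, γ) ≅ F(γ) × F(Γ//γ) between the set of maximal flags of core subgraphs of Γ that contain γ as a member and the product of the set of maximal flags of γ with the set of maximal flags of Γ//γ: a maximal flag through γ restricts to the maximal flag of core subgraphs of γ formed by its members contained in γ, and its members containing γ map under contraction by γ to the members of a maximal flag of Γ//γ. -/

import Mathlib

open scoped Classical

/-- A multigraph: finite sets of vertices and edges, where each edge is
assigned an unordered pair of (possibly equal) endpoints. -/
structure Multigraph where
  V : Type
  E : Type
  finV : Finite V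
  finE : Finite E
  ends : E → Sym2 V

attribute [instance] Multigraph.finV Multigraph.finE

namespace Multigraph

variable (G : Multigraph)

/-- `v` and `w` are joined by some edge belonging to `μ`. -/
def Step (μ : Set G.E) (v w : G.V) : Prop :=
  ∃ e ∈ μ, G.ends e = s(v, w)

/-- Connectivity with respect to the edge set `μ`, as a setoid on all vertices. -/
def connSetoid (μ : Set G.E) : Setoid G.V :=
  Relation.EqvGen.setoid (G.Step μ)

/-- The number of connected components of the spanning subgraph `(V(G), μ)`. -/
noncomputable def h0 (μ : Set G.E) : ℕ :=
  Nat.card (Quotient (G.connSetoid μ))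

/-- The first Betti number `h1 = |E| − |V| + h0` of the subgraph with edge set `μ`.
(Isolated vertices contribute equally to `|V|` and to `h0`, so this agrees with
the first Betti number of the subgraph whose vertices are the endpoints of the
edges in `μ`.) -/
noncomputable def h1 (μ : Set G.E) : ℤ :=
  (Nat.card μ : ℤ) - (Nat.card G.V : ℤ) + (G.h0 μ : ℤ)

/-- A subgraph (identified with its edge set) is core (1PI): removing any one of
its edges lowers `h1`. -/
def IsCore (μ : Set G.E) : Prop :=
  ∀ e ∈ μ, G.h1 (μ \ {e}) < G.h1 μ

/-- The multigraph is connected. -/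
def Connected : Prop := G.h0 Set.univ = 1

/-- The contraction `Γ//γ`: each connected component of `γ` is contracted to a
single vertex and the edges of `γ` are deleted. -/
def contract (γ : Set G.E) : Multigraph where
  V := Quotient (G.connSetoid γ)
  E := {e : G.E // e ∉ γ}
  finV := Quotient.finite _
  finE := Subtype.finite
  ends e := (G.ends e.1).map (Quotient.mk (G.connSetoid γ))

/-- The subgraph with edge set `γ`, as a multigraph in its own right. -/
def restrict (γ : Set G.E) : Multigraph where
  V := G.V
  E := γ
  finV := G.finV
  finE := Subtype.finite
  ends e := G.ends e.1

/-- `F` is a spanning forest: it is acyclic and consists of one spanning tree of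
each connected component (equivalently, it induces the same connectivity
relation as the full edge set). -/
def IsSpanningForest (F : Set G.E) : Prop :=
  G.h1 F = 0 ∧ G.connSetoid F = G.connSetoid Set.univ

/-- The first Kirchhoff–Symanzik (graph) polynomial
`ψ(Γ) = Σ_F Π_{e ∉ F} A_e`, the sum over spanning forests. -/
noncomputable def kirchhoff : MvPolynomial G.E ℤ :=
  ∑ᶠ F ∈ {F : Set G.E | G.IsSpanningForest F}, ∏ᶠ e ∈ Fᶜ, MvPolynomial.X e

/-- Euclidean dot product on `ℝ^D`. -/
noncomputable def dot {D : ℕ} (x y : Fin D → ℝ) : ℝ := ∑ i, x i * y i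

/-- The total momentum entering the connected component `c` of `(V(G), F)`. -/
noncomputable def momentumOf {D : ℕ} (q : G.V → Fin D → ℝ) (F : Set G.E)
    (c : Quotient (G.connSetoid F)) : Fin D → ℝ :=
  ∑ᶠ v ∈ {v : G.V | Quotient.mk (G.connSetoid F) v = c}, q v

/-- The second Kirchhoff–Symanzik polynomial
`φ(Γ) = Σ_{(T₁,T₂)} (Q(T₁)·Q(T₂)) Π_{e ∉ T₁∪T₂} A_e`, the sum over spanning
2-forests, i.e. acyclic edge sets `F` with exactly two connected components
`T₁, T₂` (jointly covering all vertices); `Q(T_i)` is the sum of the momenta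
over the vertices of `T_i`, and `Q(T₁)·Q(T₂)` is computed symmetrically via
`Q(T₁)·Q(T₂) = ((Q(T₁)+Q(T₂))² − Q(T₁)² − Q(T₂)²)/2`. -/
noncomputable def symanzik2 (D : ℕ) (q : G.V → Fin D → ℝ) : MvPolynomial G.E ℝ :=
  ∑ᶠ F ∈ {F : Set G.E | G.h1 F = 0 ∧ G.h0 F = 2},
    MvPolynomial.C
      ((dot (∑ᶠ v, q v) (∑ᶠ v, q v) -
          ∑ᶠ c : Quotient (G.connSetoid F), dot (G.momentumOf q F c) (G.momentumOf q F c)) / 2) *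
      ∏ᶠ e ∈ Fᶜ, MvPolynomial.X e

/-- External momenta pass to the contraction `Γ//γ` by assigning to each vertex
(i.e. each connected component of `γ`, or untouched vertex) the sum of the
momenta of the vertices identified to it. -/
noncomputable def contractMomenta (γ : Set G.E) {D : ℕ} (q : G.V → Fin D → ℝ) :
    (G.contract γ).V → Fin D → ℝ :=
  fun c => ∑ᶠ v ∈ {v : G.V | Quotient.mk (G.connSetoid γ) v = c}, q v

/-- A flag of core subgraphs of the subgraph `γ`: a chain (under inclusion) of
nonempty core subgraphs of `γ`, having `γ` itself as its largest member.  We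
encode a flag as its set of members. -/
def IsCoreFlagIn (γ : Set G.E) (F : Set (Set G.E)) : Prop :=
  γ ∈ F ∧ ∅ ∉ F ∧ (∀ δ ∈ F, δ ⊆ γ ∧ G.IsCore δ) ∧ IsChain (· ⊆ ·) F

/-- A maximal flag of core subgraphs of `γ`: one admitting no refinement. -/
def IsMaximalCoreFlagIn (γ : Set G.E) (F : Set (Set G.E)) : Prop :=
  G.IsCoreFlagIn γ F ∧ ∀ F' : Set (Set G.E), G.IsCoreFlagIn γ F' → F ⊆ F' → F' = F

/-- A flag of core subgraphs of `Γ`. -/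
def IsCoreFlag (F : Set (Set G.E)) : Prop := G.IsCoreFlagIn Set.univ F

/-- A maximal flag of core subgraphs of `Γ`. -/
def IsMaximalCoreFlag (F : Set (Set G.E)) : Prop := G.IsMaximalCoreFlagIn Set.univ F

end Multigraph

namespace Multigraph

variable {G : Multigraph}

theorem connSetoid_le_iff {μ : Set G.E} {r : Setoid G.V} :
    G.connSetoid μ ≤ r ↔ ∀ e ∈ μ, ∀ v w, G.ends e = s(v, w) → r v w := by
  constructor
  · intro h e he v w hvw
    exact h (Relation.EqvGen.rel _ _ ⟨e, he, hvw⟩)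
  · intro h
    apply Setoid.eqvGen_le
    rintro v w ⟨e, he, hvw⟩
    exact h e he v w hvw

theorem connSetoid_of_mem {μ : Set G.E} {e : G.E} (he : e ∈ μ) {v w : G.V}
    (h : G.ends e = s(v, w)) : G.connSetoid μ v w :=
  connSetoid_le_iff.1 le_rfl e he v w h

theorem connSetoid_mono {μ ν : Set G.E} (h : μ ⊆ ν) : G.connSetoid μ ≤ G.connSetoid ν :=
  connSetoid_le_iff.2 fun _ he _ _ => connSetoid_of_mem (h he)

theorem h0_le_iff {μ ν : Set G.E} (h : μ ⊆ ν) :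
    G.h0 μ ≤ G.h0 ν ↔ G.connSetoid ν ≤ G.connSetoid μ := by
  have hle := connSetoid_mono h
  let f : Quotient (G.connSetoid μ) → Quotient (G.connSetoid ν) :=
    Quotient.map id fun _ _ hab => hle hab
  have hf : Function.Surjective f := by
    rintro ⟨v⟩
    exact ⟨Quotient.mk _ v, rfl⟩
  constructor
  · intro hcard v w hvw
    have hbij := hf.bijective_of_nat_card_le hcard
    exact Quotient.exact (hbij.1 (Quotient.sound hvw : f (Quotient.mk _ v) = f (Quotient.mk _ w)))
  · intro hge
    rw [h0, h0, le_antisymm hle hge]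

theorem isCore_iff {μ : Set G.E} :
    G.IsCore μ ↔ ∀ e ∈ μ, ∀ v w, G.ends e = s(v, w) → G.connSetoid (μ \ {e}) v w := by
  refine forall₂_congr fun e he => ?_
  have hcard : Nat.card μ = Nat.card (μ \ {e} : Set G.E) + 1 := by
    simpa using (Set.ncard_sdiff_singleton_add_one he).symm
  have hlt : G.h1 (μ \ {e}) < G.h1 μ ↔ G.h0 (μ \ {e}) ≤ G.h0 μ := by
    unfold h1
    rw [hcard]
    push_cast
    lia
  rw [hlt, h0_le_iff Set.sdiff_subset, connSetoid_le_iff]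
  refine ⟨fun h => h e he, fun h e' he' v w hvw => ?_⟩
  by_cases hee : e' = e
  · subst hee
    exact h v w hvw
  · exact connSetoid_of_mem (μ := μ \ {e}) ⟨he', hee⟩ hvw

/-- The edge set of `Γ//γ` obtained from `δ` under contraction by `γ`. -/
def contractSet (γ δ : Set G.E) : Set (G.contract γ).E :=
  {e | e.1 ∈ δ}

/-- The edge set of `Γ` containing `γ` which contracts to `ε`. -/
def liftSet (γ : Set G.E) (ε : Set (G.contract γ).E) : Set G.E :=
  γ ∪ Subtype.val '' ε

theorem subset_liftSet (γ : Set G.E) (ε : Set (G.contract γ).E) : γ ⊆ liftSet γ ε :=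
  Set.subset_union_left

theorem contractSet_liftSet (γ : Set G.E) (ε : Set (G.contract γ).E) :
    contractSet γ (liftSet γ ε) = ε := by
  ext ⟨e, he⟩
  constructor
  · rintro (h | ⟨⟨e', he'⟩, h, rfl⟩)
    · exact absurd h he
    · exact h
  · exact fun h => Or.inr ⟨_, h, rfl⟩

theorem contractSet_subset_iff {γ δ δ' : Set G.E} (h' : γ ⊆ δ') :
    contractSet γ δ ⊆ contractSet γ δ' ↔ δ ⊆ δ' := by
  constructor
  · intro h e he
    by_cases heγ : e ∈ γ
    · exact h' heγ
    · exact @h ⟨e, heγ⟩ he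
  · exact fun h e he => h he

theorem contractSet_inj {γ δ δ' : Set G.E} (h : γ ⊆ δ) (h' : γ ⊆ δ')
    (heq : contractSet γ δ = contractSet γ δ') : δ = δ' :=
  subset_antisymm ((contractSet_subset_iff h').1 heq.le) ((contractSet_subset_iff h).1 heq.ge)

theorem contractSet_univ (γ : Set G.E) : contractSet γ Set.univ = Set.univ := rfl

theorem contractSet_self (γ : Set G.E) : contractSet γ γ = ∅ := by
  ext ⟨e, he⟩
  exact iff_of_false he id

theorem contractSet_ne_empty {γ δ : Set G.E} (h : γ ⊂ δ) : contractSet γ δ ≠ ∅ := by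
  rw [← contractSet_self]
  exact fun heq => h.ne (contractSet_inj h.1 le_rfl heq).symm

theorem ssubset_liftSet {γ : Set G.E} {ε : Set (G.contract γ).E} (h : ε ≠ ∅) :
    γ ⊂ liftSet γ ε := by
  refine (subset_liftSet γ ε).ssubset_of_ne fun heq => h ?_
  rw [← contractSet_liftSet γ ε, ← heq, contractSet_self]

/-- The vertex of `Γ//γ` to which a vertex of `Γ` is contracted. -/
def contractVertex (γ : Set G.E) (v : G.V) : (G.contract γ).V :=
  Quotient.mk (G.connSetoid γ) v

theorem contractVertex_eq {γ : Set G.E} {v w : G.V} (h : G.connSetoid γ v w) :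
    contractVertex γ v = contractVertex γ w :=
  Quotient.sound h

theorem contract_ends {γ : Set G.E} {e : G.E} (he : e ∉ γ) {v w : G.V}
    (h : G.ends e = s(v, w)) :
    (G.contract γ).ends ⟨e, he⟩ = s(contractVertex γ v, contractVertex γ w) :=
  congrArg (Sym2.map (contractVertex γ)) h

theorem exists_ends_of_contract_ends {γ : Set G.E} {e : G.E} {he : e ∉ γ}
    {p q : (G.contract γ).V} (h : (G.contract γ).ends ⟨e, he⟩ = s(p, q)) :
    ∃ v w, G.ends e = s(v, w) ∧ contractVertex γ v = p ∧ contractVertex γ w = q := by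
  obtain ⟨v, w, hvw⟩ : ∃ v w, G.ends e = s(v, w) := by
    induction h : G.ends e with | _ v w => exact ⟨v, w, rfl⟩
  rw [contract_ends he hvw, Sym2.eq_iff] at h
  obtain h | h := h
  · exact ⟨v, w, hvw, h⟩
  · exact ⟨w, v, hvw.trans Sym2.eq_swap, h.symm⟩

theorem connSetoid_contractSet {γ δ : Set G.E} (h : γ ⊆ δ) (v w : G.V) :
    (G.contract γ).connSetoid (contractSet γ δ) (contractVertex γ v) (contractVertex γ w) ↔
      G.connSetoid δ v w := by
  constructor
  · let f : (G.contract γ).V → Quotient (G.connSetoid δ) :=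
      Quotient.map id fun _ _ hab => connSetoid_mono h hab
    have hle : (G.contract γ).connSetoid (contractSet γ δ) ≤ Setoid.ker f := by
      refine connSetoid_le_iff.2 ?_
      rintro ⟨e, heγ⟩ he p q hpq
      obtain ⟨a, b, hab, rfl, rfl⟩ := exists_ends_of_contract_ends hpq
      exact Quotient.sound (connSetoid_of_mem (μ := δ) he hab)
    exact fun hvw => Quotient.exact (hle hvw)
  · have hle : G.connSetoid δ ≤
        ((G.contract γ).connSetoid (contractSet γ δ)).comap (contractVertex γ) := by
      refine connSetoid_le_iff.2 fun e he a b hab => ?_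
      rw [Setoid.comap_rel]
      by_cases heγ : e ∈ γ
      · rw [contractVertex_eq (connSetoid_of_mem heγ hab)]
      · exact connSetoid_of_mem (μ := contractSet γ δ) he (contract_ends heγ hab)
    exact fun hvw => hle hvw

theorem isCore_contractSet_iff {γ δ : Set G.E} (hγ : G.IsCore γ) (h : γ ⊆ δ) :
    (G.contract γ).IsCore (contractSet γ δ) ↔ G.IsCore δ := by
  have hsub : ∀ e ∉ γ, γ ⊆ δ \ {e} := fun e he => Set.subset_sdiff_singleton h he
  have hdiff : ∀ e (he : e ∉ γ),
      contractSet γ δ \ {⟨e, he⟩} = contractSet γ (δ \ {e}) := by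
    intro e he
    ext ⟨e', he'⟩
    exact and_congr_right fun _ => not_congr Subtype.ext_iff
  rw [isCore_iff, isCore_iff]
  constructor
  · intro hc e he v w hvw
    by_cases heγ : e ∈ γ
    · exact connSetoid_mono (Set.sdiff_subset_sdiff_left h) (isCore_iff.1 hγ e heγ v w hvw)
    · rw [← connSetoid_contractSet (hsub e heγ), ← hdiff e heγ]
      exact hc ⟨e, heγ⟩ he _ _ (contract_ends heγ hvw)
  · rintro hc ⟨e, heγ⟩ he p q hpq
    obtain ⟨a, b, hab, rfl, rfl⟩ := exists_ends_of_contract_ends hpq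
    rw [hdiff e heγ]
    exact (connSetoid_contractSet (hsub e heγ) a b).2 (hc e he a b hab)

theorem isMaximalCoreFlagIn_iff {γ : Set G.E} {F : Set (Set G.E)} :
    G.IsMaximalCoreFlagIn γ F ↔ G.IsCoreFlagIn γ F ∧
      ∀ δ ⊆ γ, δ ≠ ∅ → G.IsCore δ → (∀ ε ∈ F, δ ⊆ ε ∨ ε ⊆ δ) → δ ∈ F := by
  refine and_congr_right fun hF => ⟨fun h δ hδ hne hc hcomp => ?_, fun h F' hF' hle => ?_⟩
  · have hins := h (insert δ F) ⟨Or.inr hF.1, ?_, ?_, ?_⟩ (Set.subset_insert _ _)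
    · exact hins ▸ Set.mem_insert δ F
    · rintro (h | h)
      · exact hne h.symm
      · exact hF.2.1 h
    · rintro ε (rfl | h)
      · exact ⟨hδ, hc⟩
      · exact hF.2.2.1 ε h
    · exact hF.2.2.2.insert fun ε hε _ => hcomp ε hε
  · refine subset_antisymm (fun δ hδ => ?_) hle
    obtain ⟨hsub, hc⟩ := hF'.2.2.1 δ hδ
    exact h δ hsub (fun h0 => hF'.2.1 (h0 ▸ hδ)) hc
      fun ε hε => hF'.2.2.2.total hδ (hle hε)

/-- The members of `F` strictly containing `γ`, contracted by `γ`. -/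
def contractFlag (γ : Set G.E) (F : Set (Set G.E)) : Set (Set (G.contract γ).E) :=
  contractSet γ '' {δ ∈ F | γ ⊂ δ}

/-- The members of `F₁` together with the preimages of the members of `F₂` under contraction. -/
def glueFlag (γ : Set G.E) (F₁ : Set (Set G.E)) (F₂ : Set (Set (G.contract γ).E)) :
    Set (Set G.E) :=
  F₁ ∪ {δ | γ ⊂ δ ∧ contractSet γ δ ∈ F₂}

theorem IsMaximalCoreFlag.sep_subset {γ : Set G.E} {F : Set (Set G.E)}
    (hF : G.IsMaximalCoreFlag F) (hγF : γ ∈ F) :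
    G.IsMaximalCoreFlagIn γ {δ ∈ F | δ ⊆ γ} := by
  obtain ⟨⟨-, hne, hcore, hchain⟩, hmax⟩ := isMaximalCoreFlagIn_iff.1 hF
  refine isMaximalCoreFlagIn_iff.2 ⟨⟨⟨hγF, le_rfl⟩, fun h => hne h.1,
    fun δ hδ => ⟨hδ.2, (hcore δ hδ.1).2⟩, hchain.mono (Set.sep_subset _ _)⟩, ?_⟩
  refine fun δ hδ hδne hc hcomp => ⟨hmax δ (Set.subset_univ _) hδne hc fun ε hε => ?_, hδ⟩
  obtain h | h := hchain.total hε hγF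
  · exact hcomp ε ⟨hε, h⟩
  · exact Or.inl (hδ.trans h)

theorem IsMaximalCoreFlag.contractFlag {γ : Set G.E} {F : Set (Set G.E)}
    (hF : G.IsMaximalCoreFlag F) (hγF : γ ∈ F) (hproper : γ ≠ Set.univ) :
    (G.contract γ).IsMaximalCoreFlag (contractFlag γ F) := by
  obtain ⟨⟨huniv, -, hcore, hchain⟩, hmax⟩ := isMaximalCoreFlagIn_iff.1 hF
  have hγ : G.IsCore γ := (hcore γ hγF).2
  have hγne : γ ≠ ∅ := fun h => hF.1.2.1 (h ▸ hγF)
  refine isMaximalCoreFlagIn_iff.2 ⟨⟨?_, ?_, ?_, ?_⟩, fun ε _ hε hc hcomp => ?_⟩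
  · exact ⟨Set.univ, ⟨huniv, (Set.subset_univ γ).ssubset_of_ne hproper⟩, contractSet_univ γ⟩
  · rintro ⟨δ, hδ, h⟩
    exact contractSet_ne_empty hδ.2 h
  · rintro _ ⟨δ, hδ, rfl⟩
    exact ⟨Set.subset_univ _, (isCore_contractSet_iff hγ hδ.2.1).2 (hcore δ hδ.1).2⟩
  · rintro _ ⟨δ, hδ, rfl⟩ _ ⟨δ', hδ', rfl⟩ -
    exact (hchain.total hδ.1 hδ'.1).imp (contractSet_subset_iff hδ'.2.1).2
      (contractSet_subset_iff hδ.2.1).2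
  · have hγε := ssubset_liftSet hε
    rw [← contractSet_liftSet γ ε] at hc hcomp
    refine ⟨liftSet γ ε, ⟨?_, hγε⟩, contractSet_liftSet γ ε⟩
    refine hmax _ (Set.subset_univ _) (fun h => hγne (Set.subset_empty_iff.1 (h ▸ hγε.1)))
      ((isCore_contractSet_iff hγ hγε.1).1 hc) fun δ hδ => ?_
    by_cases hγδ : γ ⊂ δ
    · exact (hcomp _ ⟨δ, ⟨hδ, hγδ⟩, rfl⟩).imp (contractSet_subset_iff hγδ.1).1
        (contractSet_subset_iff hγε.1).1
    · obtain h | h := hchain.total hδ hγF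
      · exact Or.inr (h.trans hγε.1)
      · obtain rfl : γ = δ := by_contra fun hne => hγδ (h.ssubset_of_ne hne)
        exact Or.inr hγε.1

theorem IsMaximalCoreFlagIn.glueFlag {γ : Set G.E} (hproper : γ ≠ Set.univ)
    {F₁ : Set (Set G.E)} (hF₁ : G.IsMaximalCoreFlagIn γ F₁)
    {F₂ : Set (Set (G.contract γ).E)} (hF₂ : (G.contract γ).IsMaximalCoreFlag F₂) :
    G.IsMaximalCoreFlag (glueFlag γ F₁ F₂) := by
  obtain ⟨⟨hγF, hne₁, hcore₁, hchain₁⟩, hmax₁⟩ := isMaximalCoreFlagIn_iff.1 hF₁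
  obtain ⟨⟨huniv, hne₂, hcore₂, hchain₂⟩, hmax₂⟩ := isMaximalCoreFlagIn_iff.1 hF₂
  have hγ : G.IsCore γ := (hcore₁ γ hγF).2
  refine isMaximalCoreFlagIn_iff.2 ⟨⟨?_, ?_, ?_, ?_⟩, fun δ _ hδ hc hcomp => ?_⟩
  · exact Or.inr ⟨(Set.subset_univ γ).ssubset_of_ne hproper, huniv⟩
  · rintro (h | ⟨h, -⟩)
    · exact hne₁ h
    · exact h.2 (Set.empty_subset γ)
  · rintro δ (h | ⟨h, h'⟩)
    · exact ⟨Set.subset_univ _, (hcore₁ δ h).2⟩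
    · exact ⟨Set.subset_univ _, (isCore_contractSet_iff hγ h.1).1 (hcore₂ _ h').2⟩
  · rintro δ (h | h) δ' (h' | h') -
    · exact hchain₁.total h h'
    · exact Or.inl ((hcore₁ δ h).1.trans h'.1.1)
    · exact Or.inr ((hcore₁ δ' h').1.trans h.1.1)
    · exact (hchain₂.total h.2 h'.2).imp (contractSet_subset_iff h'.1.1).1
        (contractSet_subset_iff h.1.1).1
  · by_cases hδγ : δ ⊆ γ
    · exact Or.inl (hmax₁ δ hδγ hδ hc fun ε hε => hcomp ε (Or.inl hε))
    · have hγδ : γ ⊂ δ := ⟨(hcomp γ (Or.inl hγF)).resolve_left hδγ, hδγ⟩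
      refine Or.inr ⟨hγδ, hmax₂ _ (Set.subset_univ _) (contractSet_ne_empty hγδ)
        ((isCore_contractSet_iff hγ hγδ.1).2 hc) fun ε hε => ?_⟩
      have hγε : γ ⊂ liftSet γ ε := ssubset_liftSet fun h => hne₂ (h ▸ hε)
      rw [← contractSet_liftSet γ ε] at hε ⊢
      exact (hcomp _ (Or.inr ⟨hγε, hε⟩)).imp (contractSet_subset_iff hγε.1).2
        (contractSet_subset_iff hγδ.1).2

theorem glueFlag_contractFlag {γ : Set G.E} {F : Set (Set G.E)} (hF : IsChain (· ⊆ ·) F)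
    (hγF : γ ∈ F) : glueFlag γ {δ ∈ F | δ ⊆ γ} (contractFlag γ F) = F := by
  ext δ
  constructor
  · rintro (h | ⟨h, δ', h', heq⟩)
    · exact h.1
    · exact contractSet_inj h'.2.1 h.1 heq ▸ h'.1
  · intro hδ
    by_cases hδγ : δ ⊆ γ
    · exact Or.inl ⟨hδ, hδγ⟩
    · have hγδ : γ ⊂ δ := ⟨(hF.total hδ hγF).resolve_left hδγ, hδγ⟩
      exact Or.inr ⟨hγδ, δ, ⟨hδ, hγδ⟩, rfl⟩

theorem sep_subset_glueFlag {γ : Set G.E} {F₁ : Set (Set G.E)} (hF₁ : ∀ δ ∈ F₁, δ ⊆ γ)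
    (F₂ : Set (Set (G.contract γ).E)) : {δ ∈ glueFlag γ F₁ F₂ | δ ⊆ γ} = F₁ := by
  ext δ
  constructor
  · rintro ⟨h | h, hδ⟩
    · exact h
    · exact absurd hδ h.1.2
  · exact fun h => ⟨Or.inl h, hF₁ δ h⟩

theorem contractFlag_glueFlag {γ : Set G.E} {F₁ : Set (Set G.E)} (hF₁ : ∀ δ ∈ F₁, δ ⊆ γ)
    {F₂ : Set (Set (G.contract γ).E)} (hF₂ : ∅ ∉ F₂) :
    contractFlag γ (glueFlag γ F₁ F₂) = F₂ := by
  ext ε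
  constructor
  · rintro ⟨δ, ⟨h | h, hδ⟩, rfl⟩
    · exact absurd (hF₁ δ h) hδ.2
    · exact h.2
  · intro hε
    have hγε : γ ⊂ liftSet γ ε := ssubset_liftSet fun h => hF₂ (h ▸ hε)
    have heq := contractSet_liftSet γ ε
    exact ⟨liftSet γ ε, ⟨Or.inr ⟨hγε, heq.symm ▸ hε⟩, hγε⟩, heq⟩

/-- Maximal flags through `γ` correspond to pairs of maximal flags of `γ` and of `Γ//γ`. -/
def maximalFlagEquiv {γ : Set G.E} (hproper : γ ≠ Set.univ) :
    {F : Set (Set G.E) // G.IsMaximalCoreFlag F ∧ γ ∈ F} ≃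
      {F₁ : Set (Set G.E) // G.IsMaximalCoreFlagIn γ F₁} ×
      {F₂ : Set (Set (G.contract γ).E) // (G.contract γ).IsMaximalCoreFlag F₂} where
  toFun F := (⟨_, F.2.1.sep_subset F.2.2⟩, ⟨_, F.2.1.contractFlag F.2.2 hproper⟩)
  invFun P := ⟨glueFlag γ P.1.1 P.2.1, P.1.2.glueFlag hproper P.2.2, Or.inl P.1.2.1.1⟩
  left_inv F := Subtype.ext (glueFlag_contractFlag F.2.1.1.2.2.2 F.2.2)
  right_inv P :=
    have hsub : ∀ δ ∈ P.1.1, δ ⊆ γ := fun δ hδ => (P.1.2.1.2.2.1 δ hδ).1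
    Prod.ext (Subtype.ext (sep_subset_glueFlag hsub _))
      (Subtype.ext (contractFlag_glueFlag hsub P.2.2.1.2.1))

end Multigraph

/-- for a proper core subgraph `γ ⊊ Γ` there is a natural
bijection `F(Γ, γ) ≅ F(γ) × F(Γ//γ)`: a maximal flag through `γ` restricts to
the maximal flag of `γ` formed by its members contained in `γ`, and its members
strictly containing `γ` map under contraction by `γ` to the members of a
maximal flag of `Γ//γ`. -/
theorem flags_through_core_subgraph_equiv (G : Multigraph) (hG : G.IsCore Set.univ)
    (γ : Set G.E) (hγ : G.IsCore γ) (hproper : γ ≠ Set.univ) :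
    ∃ Φ : {F : Set (Set G.E) // G.IsMaximalCoreFlag F ∧ γ ∈ F} ≃
        {F₁ : Set (Set G.E) // G.IsMaximalCoreFlagIn γ F₁} ×
        {F₂ : Set (Set (G.contract γ).E) // (G.contract γ).IsMaximalCoreFlag F₂},
      ∀ F, ((Φ F).1.1 = {δ ∈ F.1 | δ ⊆ γ}) ∧
        ((Φ F).2.1 =
          (fun δ : Set G.E => {e : (G.contract γ).E | (e.1 : G.E) ∈ δ}) ''
            {δ ∈ F.1 | γ ⊂ δ}) := by
  exact ⟨Multigraph.maximalFlagEquiv hproper, fun _ => ⟨rfl, rfl⟩⟩
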